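/- Under the assumptions of the preceding two limits, and assuming ∫₀¹ ψ(s)ψ(s)'/σ²(s) ds is positive definite, (1/T)·(LF)'[D⁻¹ - D⁻¹F(F'D⁻¹F)⁻¹F'D⁻¹](LF) → 0 as T → ∞. -/

import Mathlib

open Matrix Filter

theorem exists_dist_le_of_continuousOn_Icc {g : ℝ → ℝ} (hg : ContinuousOn g (Set.Icc 0 1))
    {ε : ℝ} (hε : 0 < ε) :
    ∀ᶠ T : ℕ in atTop, ∀ x ∈ Set.Icc (0 : ℝ) 1, ∀ y ∈ Set.Icc (0 : ℝ) 1,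
      |x - y| ≤ 1 / T → |g x - g y| ≤ ε := by
  have huc := isCompact_Icc.uniformContinuousOn_of_continuous hg
  obtain ⟨δ, hδ, h⟩ := Metric.uniformContinuousOn_iff.1 huc ε hε
  filter_upwards [(tendsto_one_div_atTop_nhds_zero_nat (𝕜 := ℝ)).eventually_lt_const hδ]
    with T hT x hx y hy hxy
  exact (h x hx y hy (hxy.trans_lt hT)).le

theorem natCast_div_mem_Icc {k T : ℕ} (h : k ≤ T) : (k : ℝ) / T ∈ Set.Icc (0 : ℝ) 1 :=
  ⟨by positivity, div_le_one_of_le₀ (by exact_mod_cast h) (by positivity)⟩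

theorem natCast_succ_div_mem_Icc {k T : ℕ} (h : k < T) :
    ((k : ℝ) + 1) / T ∈ Set.Icc (0 : ℝ) 1 := by
  simpa using natCast_div_mem_Icc (Nat.succ_le_of_lt h)

theorem tendsto_riemannSum_Icc {g : ℝ → ℝ} (hg : ContinuousOn g (Set.Icc 0 1)) :
    Tendsto (fun T : ℕ => (1 / (T : ℝ)) * ∑ t : Fin T, g (((t : ℕ) + 1) / T)) atTop
      (nhds (∫ s in (0 : ℝ)..1, g s)) := by
  rw [Metric.tendsto_nhds]
  intro ε hε
  filter_upwards [exists_dist_le_of_continuousOn_Icc hg (half_pos hε), eventually_gt_atTop 0]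
    with T hT hT0
  have hT0' : (0 : ℝ) < T := by exact_mod_cast hT0
  have hsub : ∀ k < T, Set.uIcc ((k : ℝ) / T) (((k + 1 : ℕ) : ℝ) / T) ⊆ Set.Icc 0 1 := by
    intro k hk
    exact Set.uIcc_subset_Icc (natCast_div_mem_Icc hk.le) (natCast_div_mem_Icc hk)
  have hint : ∀ k < T, IntervalIntegrable g MeasureTheory.volume
      ((k : ℝ) / T) (((k + 1 : ℕ) : ℝ) / T) := fun k hk =>
    (hg.mono (hsub k hk)).intervalIntegrable
  have hsum := intervalIntegral.sum_integral_adjacent_intervals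
    (a := fun k : ℕ => (k : ℝ) / T) hint
  simp only [Nat.cast_zero, zero_div, div_self hT0'.ne'] at hsum
  have hlen : ∀ k : ℕ, ((k + 1 : ℕ) : ℝ) / T - (k : ℝ) / T = 1 / T := by
    intro k; push_cast; ring
  rw [Real.dist_eq, ← hsum, Fin.sum_univ_eq_sum_range (fun k => g (((k : ℕ) + 1) / T)) T,
    Finset.mul_sum, ← Finset.sum_sub_distrib]
  have hterm : ∀ k ∈ Finset.range T, |1 / (T : ℝ) * g ((k + 1) / T) -
      ∫ x in (k : ℝ) / T..((k + 1 : ℕ) : ℝ) / T, g x| ≤ ε / 2 * (1 / T) := by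
    intro k hk
    have hk := Finset.mem_range.1 hk
    have hle : (k : ℝ) / T ≤ ((k + 1 : ℕ) : ℝ) / T := by
      have := hlen k
      have : 0 < 1 / (T : ℝ) := by positivity
      linarith
    have hconst : 1 / (T : ℝ) * g ((k + 1) / T) =
        ∫ x in (k : ℝ) / T..((k + 1 : ℕ) : ℝ) / T, g ((k + 1) / T) := by
      rw [intervalIntegral.integral_const, hlen, smul_eq_mul]
    rw [hconst, ← intervalIntegral.integral_sub (by simp) (hint k hk)]
    have := intervalIntegral.norm_integral_le_of_norm_le_const (a := (k : ℝ) / T)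
      (b := ((k + 1 : ℕ) : ℝ) / T) (f := fun x => g ((k + 1) / T) - g x) (C := ε / 2) ?_
    · rwa [hlen, abs_of_pos (by positivity), Real.norm_eq_abs] at this
    · intro x hx
      have hx' := Set.uIoc_subset_uIcc hx
      refine hT _ (natCast_succ_div_mem_Icc hk) _ (hsub k hk hx') ?_
      rw [Set.uIoc_of_le hle] at hx
      have := hlen k
      push_cast at this hx
      rw [abs_of_nonneg] <;> linarith [hx.1, hx.2]
  calc _ ≤ ∑ k ∈ Finset.range T, ε / 2 * (1 / (T : ℝ)) :=
        (Finset.abs_sum_le_sum_abs _ _).trans (Finset.sum_le_sum hterm)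
    _ = ε / 2 := by simp; field_simp
    _ < ε := half_lt_self hε

/-- The exponentially weighted lag of a sequence. -/
def expLag (α : ℝ) (u : ℕ → ℝ) (t : ℕ) : ℝ := ∑ s ∈ Finset.range t, α ^ (t - s - 1) * u s

theorem expLag_succ (α : ℝ) (u : ℕ → ℝ) (t : ℕ) :
    expLag α u (t + 1) = α * expLag α u t + u t := by
  simp only [expLag, Finset.sum_range_succ, Finset.mul_sum]
  congr 1
  · refine Finset.sum_congr rfl fun s hs => ?_
    have := Finset.mem_range.1 hs
    rw [← mul_assoc, ← pow_succ']
    congr 2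
    omega
  · simp

theorem abs_expLag_sub_le {α : ℝ} (hα : |α| < 1) {u : ℕ → ℝ} {C ε : ℝ} (hC : |u 0| ≤ C)
    {T : ℕ} (hu : ∀ t, t + 1 < T → |u t - u (t + 1)| ≤ ε) {t : ℕ} (ht : t < T) :
    |expLag α u t - (1 - α)⁻¹ * u t| ≤
      |(1 - α)⁻¹| * (|α| ^ t * C + ε * ∑ k ∈ Finset.range t, |α| ^ k) := by
  have hα1 : 1 - α ≠ 0 := by linarith [(abs_lt.1 hα).2]
  induction t with
  | zero => simpa [expLag, abs_mul] using mul_le_mul_of_nonneg_left hC (abs_nonneg (1 - α)⁻¹)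
  | succ t ih =>
    have hrec : expLag α u (t + 1) - (1 - α)⁻¹ * u (t + 1) =
        α * (expLag α u t - (1 - α)⁻¹ * u t) + (1 - α)⁻¹ * (u t - u (t + 1)) := by
      rw [expLag_succ]; field_simp; ring
    rw [hrec]
    refine (abs_add_le _ _).trans ?_
    rw [abs_mul, abs_mul, geom_sum_succ]
    have h1 := mul_le_mul_of_nonneg_left (ih (by omega)) (abs_nonneg α)
    have h2 := mul_le_mul_of_nonneg_left (hu t ht) (abs_nonneg (1 - α)⁻¹)
    rw [pow_succ]
    linarith

theorem sum_abs_pow_le {α : ℝ} (hα : |α| < 1) (n : ℕ) :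
    ∑ k ∈ Finset.range n, |α| ^ k ≤ (1 - |α|)⁻¹ := by
  rw [← tsum_geometric_of_lt_one (abs_nonneg α) hα]
  exact (summable_geometric_of_lt_one (abs_nonneg α) hα).sum_le_tsum _ fun k _ => by positivity

theorem tendsto_mean_abs_expLag_sub {α : ℝ} (hα : |α| < 1) {g : ℝ → ℝ}
    (hg : ContinuousOn g (Set.Icc 0 1)) :
    Tendsto (fun T : ℕ => (1 / (T : ℝ)) * ∑ t : Fin T,
      |expLag α (fun k => g ((k + 1) / T)) t - (1 - α)⁻¹ * g (((t : ℕ) + 1) / T)|) atTop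
      (nhds 0) := by
  obtain ⟨C, hC⟩ := isCompact_Icc.exists_bound_of_continuousOn hg
  have hC0 : 0 ≤ C := (norm_nonneg _).trans (hC 0 (by simp))
  set c := |(1 - α)⁻¹|
  set G := (1 - |α|)⁻¹ with hG
  have hG0 : 0 < G := inv_pos.2 (by linarith)
  have hgeom : ∀ n : ℕ, ∑ k ∈ Finset.range n, |α| ^ k ≤ G := sum_abs_pow_le hα
  have hc0 : 0 < c := abs_pos.2 (inv_ne_zero (by linarith [(abs_lt.1 hα).2]))
  have hlim : Tendsto (fun T : ℕ => c * C * G * (1 / (T : ℝ))) atTop (nhds 0) := by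
    simpa using (tendsto_one_div_atTop_nhds_zero_nat (𝕜 := ℝ)).const_mul (c * C * G)
  rw [Metric.tendsto_nhds]
  intro ε hε
  set η := ε / 2 / (c * G) with hη
  have hη0 : 0 < η := by positivity
  filter_upwards [exists_dist_le_of_continuousOn_Icc hg hη0, eventually_gt_atTop 0,
    hlim.eventually_lt_const (half_pos hε)] with T hT hT0 hTε
  have hT0' : (0 : ℝ) < T := by exact_mod_cast hT0
  have hbound : ∀ t : Fin T,
      |expLag α (fun k => g ((k + 1) / T)) t - (1 - α)⁻¹ * g (((t : ℕ) + 1) / T)| ≤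
        c * C * |α| ^ (t : ℕ) + ε / 2 := by
    intro t
    have hstep : ∀ k, k + 1 < T →
        |g ((k + 1) / T) - g (((k + 1 : ℕ) + 1) / T)| ≤ η := by
      intro k hk
      refine hT _ (natCast_succ_div_mem_Icc (by omega)) _ (natCast_succ_div_mem_Icc hk) ?_
      have : ((k : ℝ) + 1) / T - (((k + 1 : ℕ) : ℝ) + 1) / T = -(1 / T) := by push_cast; ring
      rw [this, abs_neg, abs_of_pos (by positivity)]
    refine (abs_expLag_sub_le hα (u := fun k => g ((k + 1) / T))
      (hC _ (natCast_succ_div_mem_Icc hT0)) hstep t.2).trans ?_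
    have h := mul_le_mul_of_nonneg_left (hgeom t) (mul_pos hc0 hη0).le
    have : c * η * G = ε / 2 := by rw [hη]; field_simp
    nlinarith
  rw [Real.dist_eq, sub_zero, abs_of_nonneg (by positivity)]
  calc _ ≤ 1 / (T : ℝ) * ∑ t : Fin T, (c * C * |α| ^ (t : ℕ) + ε / 2) := by
        gcongr with t; exact hbound t
    _ = 1 / (T : ℝ) * (c * C * ∑ k ∈ Finset.range T, |α| ^ k) + ε / 2 := by
        rw [Finset.sum_add_distrib, ← Finset.mul_sum,
          Fin.sum_univ_eq_sum_range (fun k => |α| ^ k) T]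
        simp; field_simp
    _ ≤ c * C * G * (1 / (T : ℝ)) + ε / 2 := by
        have := mul_le_mul_of_nonneg_left (hgeom T)
          (show 0 ≤ 1 / (T : ℝ) * (c * C) by positivity)
        nlinarith
    _ < ε := by linarith

theorem tendsto_mean_mul_of_bounded {u v : (T : ℕ) → Fin T → ℝ} {C : ℝ}
    (hu : Tendsto (fun T : ℕ => (1 / (T : ℝ)) * ∑ t, |u T t|) atTop (nhds 0))
    (hv : ∀ T t, |v T t| ≤ C) :
    Tendsto (fun T : ℕ => (1 / (T : ℝ)) * ∑ t, u T t * v T t) atTop (nhds 0) := by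
  refine squeeze_zero_norm (fun T => ?_) (by simpa only [zero_mul] using hu.mul_const C)
  rw [norm_mul, Real.norm_of_nonneg (by positivity : 0 ≤ 1 / (T : ℝ)), mul_assoc]
  gcongr
  rw [Finset.sum_mul]
  refine (norm_sum_le _ _).trans (Finset.sum_le_sum fun t _ => ?_)
  rw [norm_mul]
  exact mul_le_mul_of_nonneg_left (hv T t) (norm_nonneg _)

theorem residual_quadratic_form {m n : Type*} [Fintype m] [DecidableEq m] [Fintype n]
    [DecidableEq n] (W : Matrix m m ℝ) (F R : Matrix m n ℝ) (c : ℝ)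
    (h : IsUnit (Fᵀ * W * F).det) :
    (c • F + R)ᵀ * (W - W * F * (Fᵀ * W * F)⁻¹ * Fᵀ * W) * (c • F + R) =
      Rᵀ * W * R - Rᵀ * W * F * (Fᵀ * W * F)⁻¹ * (Fᵀ * W * R) := by
  set M := W - W * F * (Fᵀ * W * F)⁻¹ * Fᵀ * W with hM
  have hMF : M * F = 0 := by
    have : W * F * (Fᵀ * W * F)⁻¹ * Fᵀ * W * F =
        W * F * ((Fᵀ * W * F)⁻¹ * (Fᵀ * W * F)) := by simp only [Matrix.mul_assoc]
    rw [hM, Matrix.sub_mul, this, nonsing_inv_mul _ h, Matrix.mul_one, sub_self]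
  have hFM : Fᵀ * M = 0 := by
    have : Fᵀ * (W * F * (Fᵀ * W * F)⁻¹ * Fᵀ * W) =
        ((Fᵀ * W * F) * (Fᵀ * W * F)⁻¹) * (Fᵀ * W) := by simp only [Matrix.mul_assoc]
    rw [hM, Matrix.mul_sub, this, mul_nonsing_inv _ h, Matrix.one_mul, sub_self]
  have : (c • F + R)ᵀ * M * (c • F + R) = Rᵀ * M * R := by
    simp [Matrix.add_mul, Matrix.mul_add, Matrix.mul_assoc, hMF, hFM]
  rw [this, hM, Matrix.mul_sub, Matrix.sub_mul]
  simp only [Matrix.mul_assoc]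

theorem mul_apply_eq_expLag {α : ℝ} {T : ℕ} {n : Type*} {L : Matrix (Fin T) (Fin T) ℝ}
    (hL : ∀ t s : Fin T, L t s =
      if (s : ℕ) < (t : ℕ) then α ^ ((t : ℕ) - (s : ℕ) - 1) else 0)
    {F : Matrix (Fin T) n ℝ} {i : n} {u : ℕ → ℝ} (hF : ∀ s : Fin T, F s i = u s) (t : Fin T) :
    (L * F) t i = expLag α u t := by
  simp only [Matrix.mul_apply, hL, hF, expLag]
  rw [Fin.sum_univ_eq_sum_range
    (fun s => (if s < (t : ℕ) then α ^ ((t : ℕ) - s - 1) else 0) * u s) T]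
  simp only [ite_mul, zero_mul]
  rw [← Finset.sum_filter]
  refine Finset.sum_congr ?_ fun _ _ => rfl
  ext s
  simp only [Finset.mem_filter, Finset.mem_range]
  have := t.2
  omega

theorem transpose_mul_diagonal_mul_apply {m n : Type*} [Fintype m] [DecidableEq m]
    (X Y : Matrix m n ℝ) (d : m → ℝ) (i j : n) :
    (Xᵀ * diagonal d * Y) i j = ∑ t, X t i * (d t * Y t j) := by
  rw [Matrix.mul_apply]
  simp only [Matrix.mul_diagonal, transpose_apply, mul_assoc]

theorem exists_bound_expLag_sub {α : ℝ} (hα : |α| < 1) {g : ℝ → ℝ}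
    (hg : ContinuousOn g (Set.Icc 0 1)) :
    ∃ C, ∀ (T : ℕ) (t : Fin T),
      |expLag α (fun k => g ((k + 1) / T)) t - (1 - α)⁻¹ * g (((t : ℕ) + 1) / T)| ≤ C := by
  obtain ⟨C, hC⟩ := isCompact_Icc.exists_bound_of_continuousOn hg
  have hC0 : 0 ≤ C := (norm_nonneg _).trans (hC 0 (by simp))
  refine ⟨|(1 - α)⁻¹| * (1 * C + (C + C) * (1 - |α|)⁻¹), fun T t => ?_⟩
  have hb : ∀ k < T, |g ((k + 1) / T)| ≤ C := fun k hk => hC _ (natCast_succ_div_mem_Icc hk)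
  refine (abs_expLag_sub_le hα (u := fun k => g ((k + 1) / T)) (ε := C + C)
    (hC _ (natCast_succ_div_mem_Icc t.pos))
    (fun k hk => (abs_sub _ _).trans (add_le_add (hb k (by omega)) (hb _ hk))) t.2).trans ?_
  gcongr
  · exact pow_le_one₀ (abs_nonneg α) hα.le
  · exact sum_abs_pow_le hα t

/-- Under the assumptions of the two Riemann-sum limits, and assuming
`∫₀¹ ψ(s)ψ(s)'/σ²(s) ds` is positive definite, the curvature term vanishes:
`(1/T) (LF)' [D⁻¹ - D⁻¹F(F'D⁻¹F)⁻¹F'D⁻¹] (LF) → 0` as `T → ∞`. -/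
theorem stmt_11 (r : ℕ) (α a : ℝ) (hα : |α| < 1) (ha : 0 < a)
    (ψ : ℝ → Fin r → ℝ) (σsq : ℝ → ℝ)
    (hψ : ContinuousOn ψ (Set.Icc 0 1)) (hσcont : ContinuousOn σsq (Set.Icc 0 1))
    (hσ : ∀ s ∈ Set.Icc (0:ℝ) 1, a ≤ σsq s)
    (hpos : (Matrix.of fun i j : Fin r =>
      ∫ s in (0:ℝ)..1, ψ s i * ψ s j / σsq s).PosDef)
    (L : (T : ℕ) → Matrix (Fin T) (Fin T) ℝ)
    (hL : ∀ (T : ℕ) (t s : Fin T), L T t s =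
      if (s : ℕ) < (t : ℕ) then α ^ ((t : ℕ) - (s : ℕ) - 1) else 0)
    (F : (T : ℕ) → Matrix (Fin T) (Fin r) ℝ)
    (hF : ∀ (T : ℕ) (t : Fin T) (j : Fin r), F T t j = ψ (((t : ℕ) + 1) / T) j)
    (D : (T : ℕ) → Matrix (Fin T) (Fin T) ℝ)
    (hD : ∀ T : ℕ, D T = Matrix.diagonal (fun t : Fin T => σsq (((t : ℕ) + 1) / T))) :
    Tendsto (fun T : ℕ => (1 / (T : ℝ)) •
        ((L T * F T)ᵀ *
          ((D T)⁻¹ -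
            (D T)⁻¹ * F T * ((F T)ᵀ * (D T)⁻¹ * F T)⁻¹ * (F T)ᵀ * (D T)⁻¹) *
          (L T * F T)))
      atTop (nhds (0 : Matrix (Fin r) (Fin r) ℝ)) := by
  set c := (1 - α)⁻¹
  have hσ0 : ∀ s ∈ Set.Icc (0 : ℝ) 1, 0 < σsq s := fun s hs => ha.trans_le (hσ s hs)
  have hψi : ∀ i, ContinuousOn (fun s => ψ s i) (Set.Icc 0 1) := continuousOn_pi.1 hψ
  have hinv : ContinuousOn (fun s => (σsq s)⁻¹) (Set.Icc 0 1) :=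
    hσcont.inv₀ fun s hs => (hσ0 s hs).ne'
  have hmem : ∀ (T : ℕ) (t : Fin T), (((t : ℕ) : ℝ) + 1) / T ∈ Set.Icc (0 : ℝ) 1 :=
    fun T t => natCast_succ_div_mem_Icc t.2
  set d : (T : ℕ) → Fin T → ℝ := fun T t => (σsq (((t : ℕ) + 1) / T))⁻¹ with hd
  have hDinv : ∀ T, (D T)⁻¹ = diagonal (d T) := fun T => by
    refine Matrix.inv_eq_right_inv ?_
    rw [hD, diagonal_mul_diagonal, ← diagonal_one]
    congr 1
    funext t
    exact mul_inv_cancel₀ (hσ0 _ (hmem T t)).ne'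
  set R : (T : ℕ) → Matrix (Fin T) (Fin r) ℝ := fun T => L T * F T - c • F T with hR
  have hRapply : ∀ T t i, R T t i =
      expLag α (fun k => ψ ((k + 1) / T) i) t - c * ψ (((t : ℕ) + 1) / T) i := by
    intro T t i
    change (L T * F T) t i - c * F T t i = _
    rw [mul_apply_eq_expLag (u := fun k => ψ ((k + 1) / T) i) (hL T) fun s => hF T s i, hF]
  have hRmean : ∀ i, Tendsto (fun T : ℕ => (1 / (T : ℝ)) * ∑ t, |R T t i|) atTop (nhds 0) := by
    intro i
    have h := tendsto_mean_abs_expLag_sub hα (hψi i)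
    simp only [hRapply]
    exact h
  have hcross : ∀ (Y : (T : ℕ) → Matrix (Fin T) (Fin r) ℝ),
      (∀ j, ∃ C, ∀ T t, |Y T t j| ≤ C) →
      Tendsto (fun T : ℕ => (1 / (T : ℝ)) • ((R T)ᵀ * (D T)⁻¹ * Y T)) atTop (nhds 0) := by
    intro Y hY
    refine tendsto_pi_nhds.2 fun i => tendsto_pi_nhds.2 fun j => ?_
    obtain ⟨C, hC⟩ := hY j
    simp only [hDinv, Matrix.smul_apply, transpose_mul_diagonal_mul_apply, smul_eq_mul,
      Matrix.zero_apply]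
    refine tendsto_mean_mul_of_bounded (C := a⁻¹ * C) (hRmean i) fun T t => ?_
    rw [abs_mul, abs_inv, abs_of_pos (hσ0 _ (hmem T t))]
    gcongr
    · exact hσ _ (hmem T t)
    · exact hC T t
  have hRR := hcross R fun j => by
    obtain ⟨C, hC⟩ := exists_bound_expLag_sub hα (hψi j)
    exact ⟨C, fun T t => by rw [hRapply]; exact hC T t⟩
  have hRF := hcross F fun j => by
    obtain ⟨C, hC⟩ := isCompact_Icc.exists_bound_of_continuousOn (hψi j)
    exact ⟨C, fun T t => by rw [hF]; exact hC _ (hmem T t)⟩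
  have hFR : Tendsto (fun T : ℕ => (1 / (T : ℝ)) • ((F T)ᵀ * (D T)⁻¹ * R T)) atTop (nhds 0) := by
    have h := (continuous_id.matrix_transpose.tendsto _).comp hRF
    simp only [id, transpose_zero] at h
    refine h.congr fun T => ?_
    simp [hDinv, Matrix.transpose_mul, Matrix.mul_assoc]
  set Q : Matrix (Fin r) (Fin r) ℝ :=
    Matrix.of fun i j => ∫ s in (0 : ℝ)..1, ψ s i * ψ s j / σsq s with hQ
  have hFF : Tendsto (fun T : ℕ => (1 / (T : ℝ)) • ((F T)ᵀ * (D T)⁻¹ * F T)) atTop (nhds Q) := by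
    refine tendsto_pi_nhds.2 fun i => tendsto_pi_nhds.2 fun j => ?_
    have h := tendsto_riemannSum_Icc (((hψi i).mul (hψi j)).mul hinv)
    simp only [hDinv, Matrix.smul_apply, transpose_mul_diagonal_mul_apply, smul_eq_mul, hF, hQ,
      Matrix.of_apply, div_eq_mul_inv _ (σsq _)]
    refine h.congr fun T => ?_
    congr 1
    refine Finset.sum_congr rfl fun t _ => ?_
    simp only [hd, Pi.mul_apply]
    ring
  have hQdet : Q.det ≠ 0 := hpos.det_pos.ne'
  have hFFinv : Tendsto (fun T : ℕ => ((1 / (T : ℝ)) • ((F T)ᵀ * (D T)⁻¹ * F T))⁻¹) atTop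
      (nhds Q⁻¹) :=
    (continuousAt_matrix_inv Q
      (by rw [Ring.inverse_eq_inv']; exact continuousAt_inv₀ hQdet)).tendsto.comp hFF
  have hlim := hRR.sub ((hRF.mul hFFinv).mul hFR)
  simp only [Matrix.zero_mul, sub_zero] at hlim
  have hdet : ∀ᶠ T : ℕ in atTop, ((1 / (T : ℝ)) • ((F T)ᵀ * (D T)⁻¹ * F T)).det ≠ 0 :=
    ((continuous_id.matrix_det.tendsto Q).comp hFF).eventually_ne hQdet
  refine hlim.congr' ?_
  filter_upwards [hdet, eventually_gt_atTop 0] with T hT hT0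
  have hT0' : (T : ℝ) ≠ 0 := by exact_mod_cast hT0.ne'
  have hunit : IsUnit ((F T)ᵀ * (D T)⁻¹ * F T).det := by
    rw [Matrix.det_smul] at hT
    exact (right_ne_zero_of_mul hT).isUnit
  have hLF : L T * F T = c • F T + R T := by simp [hR]
  rw [hLF, residual_quadratic_form _ _ _ _ hunit]
  have hsmul : ((1 / (T : ℝ)) • ((F T)ᵀ * (D T)⁻¹ * F T))⁻¹ =
      (T : ℝ) • ((F T)ᵀ * (D T)⁻¹ * F T)⁻¹ := by
    refine Matrix.inv_eq_right_inv ?_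
    rw [Matrix.smul_mul, Matrix.mul_smul, smul_smul, mul_nonsing_inv _ hunit,
      one_div_mul_cancel hT0', one_smul]
  rw [hsmul, smul_sub]
  simp only [Matrix.smul_mul, Matrix.mul_smul, smul_smul]
  congr 2
  field_simp
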